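/- For all s ∈ [0,1) and 1 ≤ p < 2/(s+1), there exists C(s,p) > 0 such that for all f ∈ BV(𝕋²) with mean zero, ‖f‖_{B^{s,p}_1(𝕋²)} ≤ C ‖f‖_{BV(𝕋²)}, where ‖f‖_{B^{s,p}_1} := Σ_{k≥0} 2^{sk} ‖Δ_k f‖_{L^p} is the Littlewood–Paley Besov norm. -/

import Mathlib

open MeasureTheory
open scoped ENNReal

noncomputable section

instance : Fact ((0:ℝ) < 1) := ⟨one_pos⟩

/-- The two-dimensional torus. -/
abbrev T2 : Type := AddCircle (1:ℝ) × AddCircle (1:ℝ)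

/-- Projection of `ℝ²` onto the torus. -/
def tp (p : ℝ × ℝ) : T2 := ((p.1 : AddCircle (1:ℝ)), (p.2 : AddCircle (1:ℝ)))

/-- A fundamental domain for the torus. -/
def Q : Set (ℝ × ℝ) := Set.Ioc (0:ℝ) 1 ×ˢ Set.Ioc (0:ℝ) 1

/-- Divergence of a vector field on `ℝ²`. -/
def divg (φ : ℝ × ℝ → ℝ × ℝ) (x : ℝ × ℝ) : ℝ :=
  (fderiv ℝ φ x (1, 0)).1 + (fderiv ℝ φ x (0, 1)).2

/-- `ℤ²`-periodicity of a vector field on `ℝ²`. -/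
def PerVec (φ : ℝ × ℝ → ℝ × ℝ) : Prop :=
  ∀ (x : ℝ × ℝ) (n : ℤ × ℤ), φ (x.1 + n.1, x.2 + n.2) = φ x

/-- Smooth periodic test vector fields of supremum norm at most one. -/
def TestVF : Type := {φ : ℝ × ℝ → ℝ × ℝ // ContDiff ℝ (⊤ : ℕ∞) φ ∧ PerVec φ ∧ ∀ x, ‖φ x‖ ≤ 1}

/-- The set of pairings `∫ f div φ` over test fields. -/
def bvSet (f : T2 → ℝ) : Set ℝ :=
  Set.range fun φ : TestVF => ∫ x in Q, f (tp x) * divg φ.1 x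

/-- `f ∈ BV(𝕋²)`. -/
def IsBV (f : T2 → ℝ) : Prop := Integrable f volume ∧ BddAbove (bvSet f)

/-- The BV norm on the torus, defined by duality. -/
def bvNorm (f : T2 → ℝ) : ℝ := sSup (bvSet f)

/-- The character `e^{2πi n·x}` on the torus, indexed by `n ∈ ℤ²`. -/
def char (n : ℤ × ℤ) (x : T2) : ℂ := fourier n.1 x.1 * fourier n.2 x.2

/-- Fourier coefficient of `f : 𝕋² → ℝ` at frequency `n ∈ ℤ²`. -/
def fc (f : T2 → ℝ) (n : ℤ × ℤ) : ℂ :=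
  ∫ x : T2, (f x : ℂ) * (starRingEnd ℂ) (char n x)

/-- The `k`-th Littlewood–Paley projection associated to the bump `ρ`:
`Δ_k f = F⁻¹ (ρ(2^{−k}·) F f)`. -/
def LP (ρ : ℝ × ℝ → ℝ) (k : ℕ) (f : T2 → ℝ) (x : T2) : ℂ :=
  ∑' n : ℤ × ℤ, (ρ ((2:ℝ) ^ (-(k:ℤ)) • ((n.1 : ℝ), (n.2 : ℝ))) : ℂ) * fc f n * char n x

/-- backward difference -/
def Dif (v : ℝ × ℝ) (g : ℝ × ℝ → ℝ) (ξ : ℝ × ℝ) : ℝ := g (ξ - v) - g ξ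

/-- directional derivative -/
def dv (v : ℝ × ℝ) (g : ℝ × ℝ → ℝ) (ξ : ℝ × ℝ) : ℝ := fderiv ℝ g ξ v

lemma contDiff_Dif {g : ℝ × ℝ → ℝ} (hg : ContDiff ℝ (⊤ : ℕ∞) g) (v : ℝ × ℝ) :
    ContDiff ℝ (⊤ : ℕ∞) (Dif v g) := by
  unfold Dif
  exact (hg.comp (contDiff_id.sub contDiff_const)).sub hg

lemma contDiff_dv {g : ℝ × ℝ → ℝ} (hg : ContDiff ℝ (⊤ : ℕ∞) g) (v : ℝ × ℝ) :
    ContDiff ℝ (⊤ : ℕ∞) (dv v g) := by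
  unfold dv
  exact (hg.fderiv_right (m := (⊤ : ℕ∞)) (by simp)).clm_apply contDiff_const

lemma diffb {g : ℝ × ℝ → ℝ} (hg : ContDiff ℝ (⊤ : ℕ∞) g) : Differentiable ℝ g :=
  hg.differentiable (by simp)

lemma dv_Dif {g : ℝ × ℝ → ℝ} (hg : ContDiff ℝ (⊤ : ℕ∞) g) (v w : ℝ × ℝ) :
    dv v (Dif w g) = Dif w (dv v g) := by
  funext ξ
  have hd := diffb hg
  have h1 : HasFDerivAt (fun ξ => g (ξ - w)) (fderiv ℝ g (ξ - w)) ξ := by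
    have := ((hd (ξ - w)).hasFDerivAt).comp ξ ((hasFDerivAt_id ξ).sub_const w)
    simpa [Function.comp_def] using this
  have h2 := (h1.sub (hd ξ).hasFDerivAt).fderiv
  have : fderiv ℝ (Dif w g) ξ = fderiv ℝ g (ξ - w) - fderiv ℝ g ξ := h2
  simp [dv, Dif, this]

lemma Dif_bound {g : ℝ × ℝ → ℝ} (hg : ContDiff ℝ (⊤ : ℕ∞) g) (v : ℝ × ℝ) (h B : ℝ)
    (hh : 0 ≤ h) (hB : ∀ ξ, |dv v g ξ| ≤ B) : ∀ ξ, |Dif (h • v) g ξ| ≤ h * B := by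
  intro ξ
  have hd := diffb hg
  let γ : ℝ → ℝ := fun t => g (ξ - t • v)
  have hγ : ∀ t, HasDerivAt γ (- dv v g (ξ - t • v)) t := by
    intro t
    have h1 : HasDerivAt (fun t : ℝ => ξ - t • v) (-v) t := by
      have := ((hasDerivAt_id t).smul_const v).const_sub ξ
      simpa using this
    have := (hd (ξ - t • v)).hasFDerivAt.comp_hasDerivAt t h1
    simpa [dv, Function.comp_def, γ] using this
  have := Convex.norm_image_sub_le_of_norm_hasDerivWithin_le (f := γ)
    (f' := fun t => - dv v g (ξ - t • v)) (s := Set.univ) (x := 0) (y := h) (C := B)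
    (fun t _ => (hγ t).hasDerivWithinAt) (fun t _ => by simpa using hB _) convex_univ trivial trivial
  simp only [γ, zero_smul, sub_zero, Real.norm_eq_abs, abs_of_nonneg hh] at this
  simpa [Dif, mul_comm] using this

lemma exists_bd {g : ℝ × ℝ → ℝ} (hg : ContDiff ℝ (⊤ : ℕ∞) g) (hc : HasCompactSupport g) :
    ∃ B, ∀ ξ, |g ξ| ≤ B := by
  obtain ⟨C, hC⟩ := hc.exists_bound_of_continuous hg.continuous
  exact ⟨C, hC⟩

lemma hcs_dv {g : ℝ × ℝ → ℝ} (hc : HasCompactSupport g) (v : ℝ × ℝ) :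
    HasCompactSupport (dv v g) := hc.fderiv_apply ℝ v

/-- all the difference bounds needed -/
lemma diff_bounds {g : ℝ × ℝ → ℝ} (hg : ContDiff ℝ (⊤ : ℕ∞) g) (hc : HasCompactSupport g) :
    ∃ A, 0 ≤ A ∧ ∀ h : ℝ, 0 ≤ h →
      (∀ ξ, |g ξ| ≤ A) ∧
      (∀ ξ, |Dif (h • (1, 0)) (Dif (h • (1, 0)) g) ξ| ≤ h ^ 2 * A) ∧
      (∀ ξ, |Dif (h • (0, 1)) (Dif (h • (0, 1)) g) ξ| ≤ h ^ 2 * A) ∧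
      (∀ ξ, |Dif (h • (1, 0)) (Dif (h • (1, 0)) (Dif (h • (0, 1)) (Dif (h • (0, 1)) g))) ξ|
        ≤ h ^ 4 * A) := by
  have key2 : ∀ (v : ℝ × ℝ) (u : ℝ × ℝ → ℝ) (B h : ℝ), 0 ≤ h → ContDiff ℝ (⊤ : ℕ∞) u →
      (∀ ξ, |dv v (dv v u) ξ| ≤ B) → ∀ ξ, |Dif (h • v) (Dif (h • v) u) ξ| ≤ h ^ 2 * B := by
    intro v u B h hh hu hB
    have := Dif_bound (contDiff_Dif hu (h • v)) v h (h * B) hh (by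
      rw [dv_Dif hu]
      exact Dif_bound (contDiff_dv hu v) v h B hh hB)
    intro ξ
    calc _ ≤ _ := this ξ
      _ = _ := by ring
  obtain ⟨A0, h0⟩ := exists_bd hg hc
  obtain ⟨A1, h1⟩ := exists_bd (contDiff_dv (contDiff_dv hg (1, 0)) (1, 0))
    (hcs_dv (hcs_dv hc (1, 0)) (1, 0))
  obtain ⟨A2, h2⟩ := exists_bd (contDiff_dv (contDiff_dv hg (0, 1)) (0, 1))
    (hcs_dv (hcs_dv hc (0, 1)) (0, 1))
  obtain ⟨A3, h3⟩ := exists_bd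
    (contDiff_dv (contDiff_dv (contDiff_dv (contDiff_dv hg (1, 0)) (1, 0)) (0, 1)) (0, 1))
    (hcs_dv (hcs_dv (hcs_dv (hcs_dv hc (1, 0)) (1, 0)) (0, 1)) (0, 1))
  have p0 := (abs_nonneg _).trans (h0 0)
  have p1 := (abs_nonneg _).trans (h1 0)
  have p2 := (abs_nonneg _).trans (h2 0)
  have p3 := (abs_nonneg _).trans (h3 0)
  refine ⟨A0 + A1 + A2 + A3, by linarith, fun h hh => ⟨?_, ?_, ?_, ?_⟩⟩
  · intro ξ; linarith [h0 ξ]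
  · exact key2 _ _ _ _ hh hg fun ξ => by linarith [h1 ξ]
  · exact key2 _ _ _ _ hh hg fun ξ => by linarith [h2 ξ]
  · have hs : ContDiff ℝ (⊤ : ℕ∞) (Dif (h • (0, 1)) g) := contDiff_Dif hg _
    have hs2 : ContDiff ℝ (⊤ : ℕ∞) (Dif (h • (0, 1)) (Dif (h • (0, 1)) g)) := contDiff_Dif hs _
    have := key2 (1, 0) _ (h ^ 2 * (A0 + A1 + A2 + A3)) h hh hs2 (by
      rw [dv_Dif hs, dv_Dif hg, dv_Dif (contDiff_Dif (contDiff_dv hg _) _),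
        dv_Dif (contDiff_dv hg _)]
      exact key2 (0, 1) _ _ h hh (contDiff_dv (contDiff_dv hg _) _)
        fun ξ => by linarith [h3 ξ])
    intro ξ
    calc _ ≤ _ := this ξ
      _ = _ := by ring

/-- the sub-multipliers -/
def msub (ρ : ℝ × ℝ → ℝ) (l : ℝ × ℝ → ℝ) (ξ : ℝ × ℝ) : ℝ := ρ ξ * (l ξ / (ξ.1 ^ 2 + ξ.2 ^ 2))

lemma sq_pos_of_ne {ξ : ℝ × ℝ} (h : ξ ≠ 0) : 0 < ξ.1 ^ 2 + ξ.2 ^ 2 := by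
  rcases ξ with ⟨a, b⟩
  by_cases ha : a = 0
  · have hb : b ≠ 0 := by
      rintro rfl; exact h (by simp [ha])
    positivity
  · positivity

lemma contDiff_msub {ρ : ℝ × ℝ → ℝ} (hρ : ContDiff ℝ (⊤ : ℕ∞) ρ)
    (hsupp : ∀ ξ : ℝ × ℝ, ρ ξ ≠ 0 → 1/2 < ‖ξ‖ ∧ ‖ξ‖ < 2) {l : ℝ × ℝ → ℝ}
    (hl : ContDiff ℝ (⊤ : ℕ∞) l) : ContDiff ℝ (⊤ : ℕ∞) (msub ρ l) := by
  rw [contDiff_iff_contDiffAt]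
  intro ξ
  by_cases h : ξ = 0
  · subst h
    have : msub ρ l =ᶠ[nhds 0] fun _ => 0 := by
      filter_upwards [Metric.ball_mem_nhds (0 : ℝ × ℝ) (show (0:ℝ) < 1/2 by norm_num)] with x hx
      have : ρ x = 0 := by
        by_contra hne
        have := (hsupp x hne).1
        rw [mem_ball_zero_iff] at hx
        linarith
      simp [msub, this]
    exact contDiffAt_const.congr_of_eventuallyEq this
  · unfold msub
    exact hρ.contDiffAt.mul (hl.contDiffAt.div
      ((contDiff_fst.pow 2).add (contDiff_snd.pow 2)).contDiffAt (sq_pos_of_ne h).ne')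

lemma msub_supp {ρ : ℝ × ℝ → ℝ}
    (hsupp : ∀ ξ : ℝ × ℝ, ρ ξ ≠ 0 → 1/2 < ‖ξ‖ ∧ ‖ξ‖ < 2) (l : ℝ × ℝ → ℝ) :
    ∀ ξ, 2 < ‖ξ‖ → msub ρ l ξ = 0 := by
  intro ξ h
  have : ρ ξ = 0 := by
    by_contra hne
    have := (hsupp ξ hne).2
    linarith
  simp [msub, this]

lemma hcs_of_supp {g : ℝ × ℝ → ℝ} {r : ℝ} (h : ∀ ξ, r < ‖ξ‖ → g ξ = 0) :
    HasCompactSupport g := by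
  refine HasCompactSupport.intro (isCompact_closedBall (0 : ℝ × ℝ) r) ?_
  intro x hx
  apply h
  simpa using hx

lemma msub_decomp {ρ : ℝ × ℝ → ℝ}
    (hsupp : ∀ ξ : ℝ × ℝ, ρ ξ ≠ 0 → 1/2 < ‖ξ‖ ∧ ‖ξ‖ < 2) (ξ : ℝ × ℝ) :
    ρ ξ = ξ.1 * msub ρ Prod.fst ξ + ξ.2 * msub ρ Prod.snd ξ := by
  by_cases h : ρ ξ = 0
  · simp [msub, h]
  · have h0 : ξ ≠ 0 := by
      rintro rfl
      have := (hsupp 0 h).1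
      simp at this
      linarith
    have := (sq_pos_of_ne h0).ne'
    unfold msub
    field_simp

lemma Dif_supp {g : ℝ × ℝ → ℝ} {r : ℝ} (h : ∀ ξ, r < ‖ξ‖ → g ξ = 0) {v : ℝ × ℝ} (hv : ‖v‖ ≤ 1) :
    ∀ ξ, r + 1 < ‖ξ‖ → Dif v g ξ = 0 := by
  intro ξ hξ
  have h1 : ‖ξ‖ ≤ ‖ξ - v‖ + ‖v‖ := by simpa using norm_add_le (ξ - v) v
  simp [Dif, h ξ (by linarith), h (ξ - v) (by linarith)]

/-- frequency box -/
def Box (N : ℕ) : Finset (ℤ × ℤ) :=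
  Finset.Icc (-(6 * N : ℤ)) (6 * N) ×ˢ Finset.Icc (-(6 * N : ℤ)) (6 * N)

/-- rescaled lattice point -/
def sc (N : ℕ) (n : ℤ × ℤ) : ℝ × ℝ := (N : ℝ)⁻¹ • ((n.1 : ℝ), (n.2 : ℝ))

/-- kernel with symbol `g` at scale `N` -/
def SS (N : ℕ) (g : ℝ × ℝ → ℝ) (x : T2) : ℂ := ∑' n : ℤ × ℤ, (g (sc N n) : ℂ) * char n x

lemma card_Box (N : ℕ) (hN : 1 ≤ N) : ((Box N).card : ℝ) ≤ 169 * (N : ℝ) ^ 2 := by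
  have h1 : ((6 * N : ℤ) + 1 - -(6 * N : ℤ)).toNat = 12 * N + 1 := by omega
  have : (Box N).card = (12 * N + 1) * (12 * N + 1) := by
    rw [Box, Finset.card_product, Int.card_Icc, h1]
  rw [this]
  push_cast
  have : (1 : ℝ) ≤ N := by exact_mod_cast hN
  nlinarith

lemma not_mem_Box {N : ℕ} (hN : 1 ≤ N) {n : ℤ × ℤ} (h : n ∉ Box N) : 6 < ‖sc N n‖ := by
  have hN' : (0 : ℝ) < N := by exact_mod_cast hN
  have hh : 6 * (N : ℝ) < ‖((n.1 : ℝ), (n.2 : ℝ))‖ := by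
    rw [Prod.norm_def, lt_max_iff]
    by_contra hc
    push Not at hc
    simp only [Real.norm_eq_abs, abs_le] at hc
    apply h
    simp only [Box, Finset.mem_product, Finset.mem_Icc]
    obtain ⟨⟨a, b⟩, c, d⟩ := hc
    refine ⟨⟨?_, ?_⟩, ?_, ?_⟩
    · exact_mod_cast a
    · exact_mod_cast b
    · exact_mod_cast c
    · exact_mod_cast d
  rw [sc, norm_smul, norm_inv, Real.norm_eq_abs, abs_of_pos hN', inv_mul_eq_div, lt_div_iff₀ hN']
  exact hh

lemma g_zero {N : ℕ} (hN : 1 ≤ N) {g : ℝ × ℝ → ℝ} (hg : ∀ ξ, 6 < ‖ξ‖ → g ξ = 0)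
    {n : ℤ × ℤ} (h : n ∉ Box N) : g (sc N n) = 0 := hg _ (not_mem_Box hN h)

lemma SS_eq_sum {N : ℕ} (hN : 1 ≤ N) {g : ℝ × ℝ → ℝ} (hg : ∀ ξ, 6 < ‖ξ‖ → g ξ = 0) (x : T2) :
    SS N g x = ∑ n ∈ Box N, (g (sc N n) : ℂ) * char n x := by
  rw [SS, tsum_eq_sum]
  intro n hn
  simp [g_zero hN hg hn]

lemma SS_summable {N : ℕ} (hN : 1 ≤ N) {g : ℝ × ℝ → ℝ} (hg : ∀ ξ, 6 < ‖ξ‖ → g ξ = 0) (x : T2) :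
    Summable fun n => (g (sc N n) : ℂ) * char n x := by
  apply summable_of_ne_finset_zero (s := Box N)
  intro n hn
  simp [g_zero hN hg hn]

lemma norm_char (n : ℤ × ℤ) (x : T2) : ‖char n x‖ = 1 := by
  rw [char, norm_mul, fourier_apply, fourier_apply, Circle.norm_coe, Circle.norm_coe, mul_one]

lemma continuous_char (n : ℤ × ℤ) : Continuous (char n) := by
  unfold char
  fun_prop

lemma char_add_idx (m n : ℤ × ℤ) (x : T2) : char (m + n) x = char m x * char n x := by
  simp only [char, Prod.fst_add, Prod.snd_add, fourier_add]
  ring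

lemma char_neg_idx (n : ℤ × ℤ) (x : T2) : char (-n) x = (starRingEnd ℂ) (char n x) := by
  simp only [char, Prod.fst_neg, Prod.snd_neg, fourier_neg, map_mul]

lemma char_add (n : ℤ × ℤ) (x y : T2) : char n (x + y) = char n x * char n y := by
  simp only [char, Prod.fst_add, Prod.snd_add, fourier_apply, smul_add, AddCircle.toCircle_add,
    Circle.coe_mul]
  ring

lemma char_neg (n : ℤ × ℤ) (x : T2) : char n (-x) = char (-n) x := by
  simp [char, fourier_apply]

lemma SS_bound {N : ℕ} (hN : 1 ≤ N) {g : ℝ × ℝ → ℝ} (hg : ∀ ξ, 6 < ‖ξ‖ → g ξ = 0) {A : ℝ}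
    (hA : ∀ ξ, |g ξ| ≤ A) (x : T2) : ‖SS N g x‖ ≤ 169 * (N : ℝ) ^ 2 * A := by
  have hA0 : 0 ≤ A := (abs_nonneg _).trans (hA 0)
  rw [SS_eq_sum hN hg]
  calc _ ≤ ∑ n ∈ Box N, A := norm_sum_le_of_le _ (fun n _ => by
          rw [norm_mul, norm_char, mul_one, Complex.norm_real]; exact hA _)
    _ = (Box N).card * A := by simp
    _ ≤ _ := by gcongr; exact card_Box N hN

lemma SS_continuous {N : ℕ} (hN : 1 ≤ N) {g : ℝ × ℝ → ℝ} (hg : ∀ ξ, 6 < ‖ξ‖ → g ξ = 0) :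
    Continuous (SS N g) := by
  have : SS N g = fun x => ∑ n ∈ Box N, (g (sc N n) : ℂ) * char n x := by
    funext x; exact SS_eq_sum hN hg x
  rw [this]
  have := continuous_char
  fun_prop

lemma SS_shift {N : ℕ} (hN : 1 ≤ N) {g : ℝ × ℝ → ℝ} (hg : ∀ ξ, 6 < ‖ξ‖ → g ξ = 0)
    (v : ℤ × ℤ) (x : T2) :
    (char v x - 1) * SS N g x = SS N (Dif (sc N v) g) x := by
  have hs := SS_summable hN hg x
  have e1 : ∀ n : ℤ × ℤ, sc N n - sc N v = sc N (n - v) := by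
    intro n; simp [sc, mul_sub]
  have h2 : (fun n => (g (sc N n - sc N v) : ℂ) * char n x) =
      (fun n => char v x * ((g (sc N n) : ℂ) * char n x)) ∘ (Equiv.subRight v) := by
    funext n
    simp only [Function.comp, Equiv.subRight_apply, e1]
    have : char n x = char v x * char (n - v) x := by
      rw [← char_add_idx]; simp
    rw [this]; ring
  have hs1 : Summable fun n => char v x * ((g (sc N n) : ℂ) * char n x) := hs.mul_left _
  have hs2 : Summable fun n => (g (sc N n - sc N v) : ℂ) * char n x := by
    rw [h2]; exact (Equiv.summable_iff _).2 hs1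
  have h3 : ∑' n, (g (sc N n - sc N v) : ℂ) * char n x = char v x * SS N g x := by
    rw [h2, SS, ← tsum_mul_left]
    exact Equiv.tsum_eq (Equiv.subRight v) (fun n => char v x * ((g (sc N n) : ℂ) * char n x))
  have h4 : SS N (Dif (sc N v) g) x = ∑' n, ((g (sc N n - sc N v) : ℂ) * char n x
      - (g (sc N n) : ℂ) * char n x) := by
    unfold SS Dif
    congr 1; funext n; push_cast; ring
  rw [h4, hs2.tsum_sub hs, h3, SS]
  ring

/-- one-dimensional weight -/
def wt (N : ℕ) (t : AddCircle (1 : ℝ)) : ℝ := (N : ℝ) * (1 + ((N : ℝ) * ‖fourier 1 t - 1‖) ^ 2)⁻¹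

lemma wt_continuous (N : ℕ) : Continuous (wt N) := by
  unfold wt
  refine continuous_const.mul (Continuous.inv₀ (by fun_prop) ?_)
  intro x; positivity

lemma fourier_one_lower {t : ℝ} (ht : |t| ≤ 1 / 2) :
    |t| ≤ ‖(fourier 1 (t : AddCircle (1 : ℝ)) : ℂ) - 1‖ := by
  rw [fourier_coe_apply]
  have h1 : (2 * (Real.pi : ℂ) * Complex.I * (1 : ℤ) * t / (1 : ℝ)) =
      Complex.I * ((2 * Real.pi * t : ℝ) : ℂ) := by push_cast; ring
  rw [h1, Complex.norm_exp_I_mul_ofReal_sub_one]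
  have h2 : 2 * Real.pi * t / 2 = Real.pi * t := by ring
  rw [h2, norm_mul, Real.norm_eq_abs, Real.norm_eq_abs, abs_two]
  have h3 : |Real.sin (Real.pi * t)| = |Real.sin (Real.pi * |t|)| := by
    rcases abs_cases t with ⟨h, _⟩ | ⟨h, _⟩ <;> rw [h]
    rw [mul_neg, Real.sin_neg, abs_neg]
  rw [h3]
  have hpi := Real.pi_pos
  have h4 := Real.mul_le_sin (x := Real.pi * |t|) (by positivity) (by nlinarith)
  have h5 : 2 / Real.pi * (Real.pi * |t|) = 2 * |t| := by field_simp
  rw [h5] at h4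
  have h6 := le_abs_self (Real.sin (Real.pi * |t|))
  have := abs_nonneg t
  linarith

lemma wt_integral {N : ℕ} (hN : 1 ≤ N) : ∫ t, wt N t ≤ Real.pi := by
  have hN' : (0 : ℝ) < N := by exact_mod_cast hN
  rw [← AddCircle.integral_preimage 1 (-(1/2))]
  have hintg : Integrable (fun t : ℝ => (N : ℝ) * (1 + ((N : ℝ) * t) ^ 2)⁻¹) :=
    (integrable_inv_one_add_sq.comp_mul_left' hN'.ne').const_mul _
  have hval : ∫ t : ℝ, (N : ℝ) * (1 + ((N : ℝ) * t) ^ 2)⁻¹ = Real.pi := by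
    rw [integral_const_mul, Measure.integral_comp_mul_left (fun t : ℝ => (1 + t ^ 2)⁻¹),
      integral_univ_inv_one_add_sq, abs_of_pos (inv_pos.2 hN'), smul_eq_mul,
      mul_inv_cancel_left₀ hN'.ne']
  have hcont : Continuous fun a : ℝ => wt N (a : AddCircle (1 : ℝ)) :=
    (wt_continuous N).comp (AddCircle.continuous_mk' 1)
  calc _ ≤ ∫ a in Set.Ioc (-(1/2) : ℝ) (-(1/2) + 1), (N : ℝ) * (1 + ((N : ℝ) * a) ^ 2)⁻¹ := by
        apply setIntegral_mono_on (hcont.integrableOn_Ioc) hintg.integrableOn measurableSet_Ioc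
        intro t ht
        have ht' : |t| ≤ 1 / 2 := by
          rw [abs_le]; constructor <;> linarith [ht.1, ht.2]
        have h1 := fourier_one_lower ht'
        have h2 : ((N : ℝ) * t) ^ 2 ≤
            ((N : ℝ) * ‖(fourier 1 (t : AddCircle (1 : ℝ)) : ℂ) - 1‖) ^ 2 := by
          rw [← sq_abs, abs_mul, abs_of_pos hN']
          gcongr
        unfold wt
        gcongr
    _ ≤ ∫ t : ℝ, (N : ℝ) * (1 + ((N : ℝ) * t) ^ 2)⁻¹ :=
        setIntegral_le_integral hintg (Filter.Eventually.of_forall fun t => by positivity)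
    _ = _ := hval

lemma SS_L1 {g : ℝ × ℝ → ℝ} (hg : ContDiff ℝ (⊤ : ℕ∞) g) (hs : ∀ ξ, 2 < ‖ξ‖ → g ξ = 0) :
    ∃ C, 0 ≤ C ∧ ∀ N : ℕ, 1 ≤ N → (∀ x, ‖SS N g x‖ ≤ C * (N : ℝ) ^ 2) ∧ ∫ x, ‖SS N g x‖ ≤ C := by
  obtain ⟨A, hA0, hA⟩ := diff_bounds hg (hcs_of_supp hs)
  have hpi := Real.pi_gt_three
  refine ⟨676 * A * (Real.pi * Real.pi), by positivity, fun N hN => ?_⟩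
  have hN' : (0 : ℝ) < N := by exact_mod_cast hN
  have hN1 : (1 : ℝ) ≤ N := by exact_mod_cast hN
  have hinv : (N : ℝ)⁻¹ ≤ 1 := inv_le_one_of_one_le₀ hN1
  obtain ⟨b0, b1, b2, b3⟩ := hA (N : ℝ)⁻¹ (inv_nonneg.2 hN'.le)
  have sc1 : sc N (1, 0) = (N : ℝ)⁻¹ • ((1 : ℝ), (0 : ℝ)) := by simp [sc]
  have sc2 : sc N (0, 1) = (N : ℝ)⁻¹ • ((0 : ℝ), (1 : ℝ)) := by simp [sc]
  rw [← sc1] at b1 b3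
  rw [← sc2] at b2 b3
  have n1 : ‖sc N (1, 0)‖ ≤ 1 := by
    rw [sc1, norm_smul, Prod.norm_def]; simpa using hinv
  have n2 : ‖sc N (0, 1)‖ ≤ 1 := by
    rw [sc2, norm_smul, Prod.norm_def]; simpa using hinv
  have up : ∀ {u : ℝ × ℝ → ℝ} {r : ℝ}, r ≤ 6 → (∀ ξ, r < ‖ξ‖ → u ξ = 0) →
      ∀ ξ, 6 < ‖ξ‖ → u ξ = 0 := fun h hu ξ hξ => hu ξ (h.trans_lt hξ)
  have s1 := Dif_supp hs n1
  have s11 := Dif_supp s1 n1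
  have s2 := Dif_supp hs n2
  have s22 := Dif_supp s2 n2
  have s122 := Dif_supp s22 n1
  have s1122 := Dif_supp s122 n1
  have hs6 := up (by norm_num) hs
  have key : ∀ x : T2, ‖SS N g x‖ ≤ 676 * A * (wt N x.1 * wt N x.2) := by
    intro x
    set a := ‖(fourier 1 x.1 : ℂ) - 1‖ with ha
    set b := ‖(fourier 1 x.2 : ℂ) - 1‖ with hb
    have ca : char (1, 0) x = fourier 1 x.1 := by simp [char]
    have cb : char (0, 1) x = fourier 1 x.2 := by simp [char]
    have k0 := SS_bound hN hs6 b0 x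
    have k1 := SS_bound hN (up (by norm_num) s11) b1 x
    have k2 := SS_bound hN (up (by norm_num) s22) b2 x
    have k3 := SS_bound hN (up (by norm_num) s1122) b3 x
    rw [← SS_shift hN (up (by norm_num) s1), ← SS_shift hN hs6, norm_mul, norm_mul, ca, ← ha] at k1
    rw [← SS_shift hN (up (by norm_num) s122), ← SS_shift hN (up (by norm_num) s22),
      ← SS_shift hN (up (by norm_num) s2), ← SS_shift hN hs6, norm_mul, norm_mul, norm_mul,
      norm_mul, ca, cb, ← ha, ← hb] at k3
    rw [← SS_shift hN (up (by norm_num) s2), ← SS_shift hN hs6, norm_mul, norm_mul, cb, ← hb] at k2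
    set M := ‖SS N g x‖ with hM
    have e1 : (N : ℝ) ^ 2 * ((N : ℝ)⁻¹ ^ 2) = 1 := by field_simp
    have e2 : (N : ℝ) ^ 4 * ((N : ℝ)⁻¹ ^ 4) = 1 := by field_simp
    have j1 : (N * a) ^ 2 * M ≤ 169 * N ^ 2 * A := by
      calc (N * a) ^ 2 * M = N ^ 2 * (a * (a * M)) := by ring
        _ ≤ N ^ 2 * (169 * (N : ℝ) ^ 2 * ((N : ℝ)⁻¹ ^ 2 * A)) := by gcongr
        _ = ((N : ℝ) ^ 2 * ((N : ℝ)⁻¹ ^ 2)) * (169 * N ^ 2 * A) := by ring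
        _ = _ := by rw [e1, one_mul]
    have j2 : (N * b) ^ 2 * M ≤ 169 * N ^ 2 * A := by
      calc (N * b) ^ 2 * M = N ^ 2 * (b * (b * M)) := by ring
        _ ≤ N ^ 2 * (169 * (N : ℝ) ^ 2 * ((N : ℝ)⁻¹ ^ 2 * A)) := by gcongr
        _ = ((N : ℝ) ^ 2 * ((N : ℝ)⁻¹ ^ 2)) * (169 * N ^ 2 * A) := by ring
        _ = _ := by rw [e1, one_mul]
    have j3 : (N * a) ^ 2 * (N * b) ^ 2 * M ≤ 169 * N ^ 2 * A := by
      calc (N * a) ^ 2 * (N * b) ^ 2 * M = N ^ 4 * (a * (a * (b * (b * M)))) := by ring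
        _ ≤ N ^ 4 * (169 * (N : ℝ) ^ 2 * ((N : ℝ)⁻¹ ^ 4 * A)) := by gcongr
        _ = ((N : ℝ) ^ 4 * ((N : ℝ)⁻¹ ^ 4)) * (169 * N ^ 2 * A) := by ring
        _ = _ := by rw [e2, one_mul]
    have hfin : M * ((1 + (N * a) ^ 2) * (1 + (N * b) ^ 2)) ≤ 676 * A * N ^ 2 := by
      nlinarith
    have : 676 * A * (wt N x.1 * wt N x.2) =
        (676 * A * N ^ 2) / ((1 + (N * a) ^ 2) * (1 + (N * b) ^ 2)) := by
      unfold wt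
      rw [← ha, ← hb]
      field_simp
    rw [this, le_div_iff₀ (by positivity)]
    exact hfin
  constructor
  · intro x
    have := SS_bound hN hs6 b0 x
    refine this.trans ?_
    have h9 : (9:ℝ) ≤ Real.pi * Real.pi := by nlinarith
    have h10 : 169 ≤ 676 * (Real.pi * Real.pi) := by linarith
    have : 169 * (A * (N : ℝ) ^ 2) ≤ 676 * (Real.pi * Real.pi) * (A * (N : ℝ) ^ 2) := by gcongr
    linarith
  · have hc := (SS_continuous hN hs6).norm
    have hc2 : Continuous fun x : T2 => 676 * A * (wt N x.1 * wt N x.2) := by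
      have := wt_continuous N
      fun_prop
    have i1 : Integrable (fun x => ‖SS N g x‖) :=
      hc.integrable_of_hasCompactSupport (HasCompactSupport.of_compactSpace _)
    have i2 : Integrable (fun x : T2 => 676 * A * (wt N x.1 * wt N x.2)) :=
      hc2.integrable_of_hasCompactSupport (HasCompactSupport.of_compactSpace _)
    refine (integral_mono i1 i2 key).trans ?_
    rw [integral_const_mul]
    have : ∫ x : T2, wt N x.1 * wt N x.2 = (∫ t, wt N t) * ∫ t, wt N t :=
      integral_prod_mul (μ := (volume : Measure (AddCircle (1 : ℝ))))
        (ν := (volume : Measure (AddCircle (1 : ℝ)))) (wt N) (wt N)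
    rw [this]
    have hw := wt_integral hN
    have hw0 : 0 ≤ ∫ t, wt N t := integral_nonneg fun t => by unfold wt; positivity
    gcongr

lemma tp_measurePreserving : MeasurePreserving tp (volume.restrict Q) (volume : Measure T2) := by
  have h := AddCircle.measurePreserving_mk 1 0
  rw [zero_add] at h
  have h2 := h.prod h
  rw [Measure.prod_restrict] at h2
  exact h2

/-- phase as a linear map -/
def Lph (n : ℤ × ℤ) : ℝ × ℝ →L[ℝ] ℂ :=
  (-(2 * Real.pi * Complex.I * n.1) : ℂ) • Complex.ofRealCLM.comp (ContinuousLinearMap.fst ℝ ℝ ℝ) +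
  (-(2 * Real.pi * Complex.I * n.2) : ℂ) • Complex.ofRealCLM.comp (ContinuousLinearMap.snd ℝ ℝ ℝ)

lemma Lph_apply (n : ℤ × ℤ) (x : ℝ × ℝ) : Lph n x =
    -(2 * Real.pi * Complex.I * n.1) * x.1 + -(2 * Real.pi * Complex.I * n.2) * x.2 := by
  simp [Lph]

lemma exp_Lph (n : ℤ × ℤ) (x : ℝ × ℝ) : Complex.exp (Lph n x) = char (-n) (tp x) := by
  rw [Lph_apply, Complex.exp_add, char, tp]
  simp only [fourier_coe_apply]
  congr 2 <;> · simp

/-- real part of a trigonometric polynomial on the plane -/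
def Ptr (F : Finset (ℤ × ℤ)) (c : ℂ) (a : ℤ × ℤ → ℂ) (x : ℝ × ℝ) : ℝ :=
  Complex.reCLM (c * ∑ n ∈ F, a n * Complex.exp (Lph n x))

lemma Ptr_contDiff (F : Finset (ℤ × ℤ)) (c : ℂ) (a : ℤ × ℤ → ℂ) :
    ContDiff ℝ (⊤ : ℕ∞) (Ptr F c a) := by
  unfold Ptr
  refine Complex.reCLM.contDiff.comp (contDiff_const.mul (ContDiff.sum fun n _ => ?_))
  exact contDiff_const.mul (Lph n).contDiff.cexp

lemma Ptr_hasFDerivAt (F : Finset (ℤ × ℤ)) (c : ℂ) (a : ℤ × ℤ → ℂ) (x : ℝ × ℝ) :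
    HasFDerivAt (Ptr F c a)
      (Complex.reCLM.comp (c • ∑ n ∈ F, a n • (Complex.exp (Lph n x) • Lph n))) x := by
  unfold Ptr
  refine Complex.reCLM.hasFDerivAt.comp x (HasFDerivAt.const_mul ?_ c)
  refine HasFDerivAt.fun_sum fun n _ => ?_
  exact HasFDerivAt.const_mul (Lph n).hasFDerivAt.cexp (a n)

lemma char_integrable {f : T2 → ℝ} (hf : Integrable f volume) (n : ℤ × ℤ) :
    Integrable (fun x => (f x : ℂ) * char n x) volume := by
  refine hf.ofReal.mul_bdd (c := 1) (continuous_char n).aestronglyMeasurable ?_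
  exact Filter.Eventually.of_forall fun x => (norm_char n x).le

lemma pairing {f : T2 → ℝ} (hf : IsBV f) (F : Finset (ℤ × ℤ)) (a b : ℤ × ℤ → ℂ) {B : ℝ}
    (hB : 0 < B) (ha : ∀ y : T2, ‖∑ n ∈ F, a n * char (-n) y‖ ≤ B)
    (hb : ∀ y : T2, ‖∑ n ∈ F, b n * char (-n) y‖ ≤ B) :
    ‖∑ n ∈ F, ((n.1 : ℂ) * a n + n.2 * b n) * fc f n‖ ≤ B * bvNorm f := by
  set Z := ∑ n ∈ F, ((n.1 : ℂ) * a n + n.2 * b n) * fc f n with hZ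
  obtain ⟨u, hu, huZ⟩ := RCLike.exists_norm_eq_mul_self Z
  set c : ℂ := u * Complex.I / B with hc
  have hcn : ‖c‖ = B⁻¹ := by
    rw [hc, norm_div, norm_mul, hu, Complex.norm_I, Complex.norm_real, Real.norm_eq_abs,
      abs_of_pos hB]
    simp
  have hbd : ∀ (d : ℤ × ℤ → ℂ), (∀ y : T2, ‖∑ n ∈ F, d n * char (-n) y‖ ≤ B) →
      ∀ x, ‖Ptr F c d x‖ ≤ 1 := by
    intro d hd x
    simp only [Ptr, exp_Lph]
    refine (Complex.abs_re_le_norm _).trans ?_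
    rw [norm_mul, hcn, inv_mul_le_iff₀ hB, mul_one]
    exact hd _
  have hper : ∀ (d : ℤ × ℤ → ℂ) (x : ℝ × ℝ) (n : ℤ × ℤ),
      Ptr F c d (x.1 + n.1, x.2 + n.2) = Ptr F c d x := by
    intro d x n
    have : tp (x.1 + n.1, x.2 + n.2) = tp x := by
      simp [tp]
    simp only [Ptr, exp_Lph, this]
  let φ : TestVF := ⟨fun x => (Ptr F c a x, Ptr F c b x),
    (Ptr_contDiff F c a).prodMk (Ptr_contDiff F c b),
    fun x n => by simp only [hper], fun x => by
      rw [Prod.norm_def]; exact max_le (hbd a ha x) (hbd b hb x)⟩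
  have hdiv : ∀ x, divg φ.1 x = Complex.reCLM (∑ n ∈ F,
      (c * (-(2 * Real.pi * Complex.I)) * ((n.1 : ℂ) * a n + n.2 * b n)) * char (-n) (tp x)) := by
    intro x
    have h1 : HasFDerivAt φ.1 _ x := (Ptr_hasFDerivAt F c a x).prodMk (Ptr_hasFDerivAt F c b x)
    rw [divg, h1.fderiv]
    simp only [ContinuousLinearMap.prod_apply, ContinuousLinearMap.comp_apply,
      _root_.smul_apply, _root_.sum_apply, smul_eq_mul, exp_Lph]
    simp only [Lph_apply]
    rw [← map_add, ← mul_add, ← Finset.sum_add_distrib, Finset.mul_sum]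
    congr 1
    refine Finset.sum_congr rfl fun n _ => ?_
    push_cast
    ring
  have hfi := hf.1
  have hintg : ∫ x in Q, f (tp x) * divg φ.1 x = 2 * Real.pi * ‖Z‖ / B := by
    let G : T2 → ℝ := fun y => f y * Complex.reCLM (∑ n ∈ F,
      (c * (-(2 * Real.pi * Complex.I)) * ((n.1 : ℂ) * a n + n.2 * b n)) * char (-n) y)
    have hG : G = fun y => Complex.reCLM (∑ n ∈ F,
      (c * (-(2 * Real.pi * Complex.I)) * ((n.1 : ℂ) * a n + n.2 * b n)) *
        ((f y : ℂ) * char (-n) y)) := by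
      funext y
      have : ∑ n ∈ F, (c * (-(2 * Real.pi * Complex.I)) * ((n.1 : ℂ) * a n + n.2 * b n)) *
        ((f y : ℂ) * char (-n) y) = (f y : ℂ) * ∑ n ∈ F,
        (c * (-(2 * Real.pi * Complex.I)) * ((n.1 : ℂ) * a n + n.2 * b n)) * char (-n) y := by
        rw [Finset.mul_sum]
        exact Finset.sum_congr rfl fun n _ => by ring
      rw [this]
      simp only [G, Complex.reCLM_apply, Complex.re_ofReal_mul]
    have hi : ∀ n ∈ F, Integrable (fun y => (c * (-(2 * Real.pi * Complex.I)) *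
        ((n.1 : ℂ) * a n + n.2 * b n)) * ((f y : ℂ) * char (-n) y)) (volume : Measure T2) :=
      fun n _ => (char_integrable hfi (-n)).const_mul _
    have hisum := integrable_finsetSum F hi
    have hGi : Integrable G volume := by
      rw [hG]; exact Complex.reCLM.integrable_comp hisum
    have e1 : ∫ x in Q, f (tp x) * divg φ.1 x = ∫ x in Q, G (tp x) := by
      simp only [hdiv, G]
    have e2 : ∫ x in Q, G (tp x) = ∫ y, G y := by
      rw [← tp_measurePreserving.map_eq, integral_map tp_measurePreserving.measurable.aemeasurable]
      rw [tp_measurePreserving.map_eq]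
      exact hGi.aestronglyMeasurable
    rw [e1, e2, hG, ContinuousLinearMap.integral_comp_comm _ hisum, integral_finsetSum F hi]
    have e3 : ∑ n ∈ F, ∫ y, (c * (-(2 * Real.pi * Complex.I)) * ((n.1 : ℂ) * a n + n.2 * b n)) *
        ((f y : ℂ) * char (-n) y) = c * (-(2 * Real.pi * Complex.I)) * Z := by
      rw [hZ, Finset.mul_sum]
      refine Finset.sum_congr rfl fun n _ => ?_
      rw [integral_const_mul, fc]
      simp only [char_neg_idx]
      ring
    rw [e3]
    have e4 : c * (-(2 * Real.pi * Complex.I)) * Z = ((2 * Real.pi * ‖Z‖ / B : ℝ) : ℂ) := by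
      push_cast
      have huZ' : (‖Z‖ : ℂ) = u * Z := huZ
      rw [huZ', hc]
      linear_combination (-(2 * Real.pi * u * Z / B : ℂ)) * Complex.I_sq
    rw [e4]
    simp
  have hle : 2 * Real.pi * ‖Z‖ / B ≤ bvNorm f := by
    rw [← hintg]
    exact le_csSup hf.2 ⟨φ, rfl⟩
  rw [div_le_iff₀ hB] at hle
  have := Real.pi_gt_three
  nlinarith [norm_nonneg Z]

lemma bvNorm_nonneg {f : T2 → ℝ} (hf : IsBV f) : 0 ≤ bvNorm f := by
  have := pairing hf ∅ 0 0 one_pos (by simp) (by simp)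
  simpa using this

lemma main_pair {ρ : ℝ × ℝ → ℝ}
    (hsupp : ∀ ξ : ℝ × ℝ, ρ ξ ≠ 0 → 1/2 < ‖ξ‖ ∧ ‖ξ‖ < 2) {f : T2 → ℝ} (hf : IsBV f)
    {N : ℕ} (hN : 1 ≤ N) (q : ℤ × ℤ → ℂ) {B : ℝ} (hB : 0 < B)
    (h1 : ∀ y : T2, ‖∑ n ∈ Box N, ((msub ρ Prod.fst (sc N n) : ℂ) * q n) * char (-n) y‖ ≤ B)
    (h2 : ∀ y : T2, ‖∑ n ∈ Box N, ((msub ρ Prod.snd (sc N n) : ℂ) * q n) * char (-n) y‖ ≤ B) :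
    ‖∑ n ∈ Box N, (ρ (sc N n) : ℂ) * fc f n * q n‖ ≤ (N : ℝ)⁻¹ * (B * bvNorm f) := by
  have := pairing hf (Box N) _ _ hB h1 h2
  have hN' : (0 : ℝ) < N := by exact_mod_cast hN
  have e : ∑ n ∈ Box N, (ρ (sc N n) : ℂ) * fc f n * q n = ((N : ℝ)⁻¹ : ℂ) *
      ∑ n ∈ Box N, ((n.1 : ℂ) * ((msub ρ Prod.fst (sc N n) : ℂ) * q n) +
        n.2 * ((msub ρ Prod.snd (sc N n) : ℂ) * q n)) * fc f n := by
    rw [Finset.mul_sum]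
    refine Finset.sum_congr rfl fun n _ => ?_
    rw [msub_decomp hsupp (sc N n)]
    have a1 : (sc N n).1 = (N : ℝ)⁻¹ * n.1 := by simp [sc]
    have a2 : (sc N n).2 = (N : ℝ)⁻¹ * n.2 := by simp [sc]
    rw [a1, a2]
    push_cast
    ring
  rw [e, norm_mul]
  have : ‖((N : ℝ)⁻¹ : ℂ)‖ = (N : ℝ)⁻¹ := by simp
  rw [this]
  gcongr

lemma LP_eq_sum {ρ : ℝ × ℝ → ℝ}
    (hsupp : ∀ ξ : ℝ × ℝ, ρ ξ ≠ 0 → 1/2 < ‖ξ‖ ∧ ‖ξ‖ < 2) (f : T2 → ℝ) (k : ℕ) (x : T2) :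
    LP ρ k f x = ∑ n ∈ Box (2 ^ k), (ρ (sc (2 ^ k) n) : ℂ) * fc f n * char n x := by
  have hsc : ∀ n : ℤ × ℤ, (2:ℝ) ^ (-(k:ℤ)) • ((n.1 : ℝ), (n.2 : ℝ)) = sc (2 ^ k) n := by
    intro n; simp [sc]
  simp only [LP, hsc]
  refine tsum_eq_sum fun n hn => ?_
  have h0 : ρ (sc (2 ^ k) n) = 0 := by
    by_contra h
    have h3 := (hsupp _ h).2
    have h4 := not_mem_Box Nat.one_le_two_pow hn
    linarith
  simp [h0]

lemma SS_sub {N : ℕ} (hN : 1 ≤ N) {g : ℝ × ℝ → ℝ} (hg : ∀ ξ, 6 < ‖ξ‖ → g ξ = 0) (x y : T2) :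
    SS N g (x - y) = ∑ n ∈ Box N, ((g (sc N n) : ℂ) * char n x) * char (-n) y := by
  rw [SS_eq_sum hN hg]
  refine Finset.sum_congr rfl fun n _ => ?_
  rw [sub_eq_add_neg, char_add, char_neg]
  ring

lemma LP_continuous {ρ : ℝ × ℝ → ℝ}
    (hsupp : ∀ ξ : ℝ × ℝ, ρ ξ ≠ 0 → 1/2 < ‖ξ‖ ∧ ‖ξ‖ < 2) (f : T2 → ℝ) (k : ℕ) :
    Continuous (LP ρ k f) := by
  have : LP ρ k f = fun x => ∑ n ∈ Box (2 ^ k), (ρ (sc (2 ^ k) n) : ℂ) * fc f n * char n x := by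
    funext x; exact LP_eq_sum hsupp f k x
  rw [this]
  have := continuous_char
  fun_prop

lemma LP_bounds {ρ : ℝ × ℝ → ℝ} (hρ : ContDiff ℝ (⊤ : ℕ∞) ρ)
    (hsupp : ∀ ξ : ℝ × ℝ, ρ ξ ≠ 0 → 1/2 < ‖ξ‖ ∧ ‖ξ‖ < 2) :
    ∃ C : ℝ, 0 < C ∧ ∀ f : T2 → ℝ, IsBV f → ∀ k : ℕ,
      (∀ x, ‖LP ρ k f x‖ ≤ (2:ℝ) ^ k * (C * bvNorm f)) ∧
      ∫ x, ‖LP ρ k f x‖ ≤ ((2:ℝ) ^ k)⁻¹ * (C * bvNorm f) := by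
  obtain ⟨C1, hC1, H1⟩ := SS_L1 (contDiff_msub hρ hsupp contDiff_fst) (msub_supp hsupp Prod.fst)
  obtain ⟨C2, hC2, H2⟩ := SS_L1 (contDiff_msub hρ hsupp contDiff_snd) (msub_supp hsupp Prod.snd)
  have z1 : ∀ ξ, 6 < ‖ξ‖ → msub ρ Prod.fst ξ = 0 :=
    fun ξ h => msub_supp hsupp _ ξ (by linarith)
  have z2 : ∀ ξ, 6 < ‖ξ‖ → msub ρ Prod.snd ξ = 0 :=
    fun ξ h => msub_supp hsupp _ ξ (by linarith)
  refine ⟨C1 + C2 + 1, by positivity, fun f hf k => ?_⟩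
  set N : ℕ := 2 ^ k with hNk
  have hN : 1 ≤ N := Nat.one_le_two_pow
  have hN' : (0 : ℝ) < N := by exact_mod_cast hN
  have hNc : (2:ℝ) ^ k = N := by simp [hNk]
  rw [hNc]
  constructor
  · intro x
    rw [LP_eq_sum hsupp]
    have := main_pair hsupp hf hN (fun n => char n x) (B := (C1 + C2 + 1) * (N : ℝ) ^ 2)
      (by positivity) ?_ ?_
    · refine this.trans (le_of_eq ?_)
      field_simp
    · intro y
      rw [← SS_sub hN z1]
      refine ((H1 N hN).1 _).trans ?_
      gcongr; linarith
    · intro y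
      rw [← SS_sub hN z2]
      refine ((H2 N hN).1 _).trans ?_
      gcongr; linarith
  · have hcont := LP_continuous hsupp f k
    let g : T2 → ℂ := fun x => (starRingEnd ℂ) (LP ρ k f x) / (‖LP ρ k f x‖ : ℂ)
    have hgm : Measurable g := by
      have h1 : Measurable (LP ρ k f) := hcont.measurable
      have h2 : Measurable fun x => (starRingEnd ℂ) (LP ρ k f x) :=
        (Complex.continuous_conj.comp hcont).measurable
      exact h2.div (Complex.measurable_ofReal.comp h1.norm)
    have hg1 : ∀ x, ‖g x‖ ≤ 1 := by
      intro x
      simp only [g, norm_div, RCLike.norm_conj, Complex.norm_real, norm_norm]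
      exact div_self_le_one _
    have hgL : ∀ x, (‖LP ρ k f x‖ : ℂ) = g x * LP ρ k f x := by
      intro x
      simp only [g]
      by_cases h : LP ρ k f x = 0
      · simp [h]
      · have h' : (‖LP ρ k f x‖ : ℂ) ≠ 0 := by exact_mod_cast norm_ne_zero_iff.2 h
        field_simp
        rw [mul_comm, Complex.mul_conj, Complex.normSq_eq_norm_sq]
        push_cast; rfl
    have gint : ∀ (u : T2 → ℂ), Continuous u → Integrable (fun x => g x * u x) volume := by
      intro u hu
      have hui : Integrable u volume :=
        hu.integrable_of_hasCompactSupport (HasCompactSupport.of_compactSpace _)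
      exact hui.bdd_mul (c := 1) hgm.aestronglyMeasurable (Filter.Eventually.of_forall hg1)
    have conv : ∀ (m : ℝ × ℝ → ℝ), (∀ ξ, 6 < ‖ξ‖ → m ξ = 0) → ∀ y : T2,
        ‖∑ n ∈ Box N, ((m (sc N n) : ℂ) * ∫ x, g x * char n x) * char (-n) y‖
          ≤ ∫ x, ‖SS N m x‖ := by
      intro m hm y
      have e : ∑ n ∈ Box N, ((m (sc N n) : ℂ) * ∫ x, g x * char n x) * char (-n) y
          = ∫ x, g x * SS N m (x - y) := by
        simp only [SS_sub hN hm, Finset.mul_sum]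
        rw [integral_finsetSum]
        · refine Finset.sum_congr rfl fun n _ => ?_
          rw [mul_right_comm, ← integral_const_mul]
          congr 1; funext x; ring
        · intro n _
          apply gint
          exact (continuous_const.mul (continuous_char n)).mul continuous_const
      rw [e]
      have : (volume : Measure T2).IsAddLeftInvariant :=
        inferInstanceAs ((volume : Measure (AddCircle (1 : ℝ))).prod
          (volume : Measure (AddCircle (1 : ℝ)))).IsAddLeftInvariant
      have hc : Continuous fun x => SS N m (x - y) :=
        (SS_continuous hN hm).comp (continuous_id.sub continuous_const)
      calc _ ≤ ∫ x, ‖SS N m (x - y)‖ := by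
            refine norm_integral_le_of_norm_le
              (hc.norm.integrable_of_hasCompactSupport (HasCompactSupport.of_compactSpace _)) ?_
            refine Filter.Eventually.of_forall fun x => ?_
            rw [norm_mul]
            exact mul_le_of_le_one_left (norm_nonneg _) (hg1 x)
        _ = _ := integral_sub_right_eq_self (fun x => ‖SS N m x‖) y
    have hval : ((∫ x, ‖LP ρ k f x‖ : ℝ) : ℂ) =
        ∑ n ∈ Box N, (ρ (sc N n) : ℂ) * fc f n * ∫ x, g x * char n x := by
      rw [← integral_complex_ofReal]
      simp only [hgL]
      simp only [LP_eq_sum hsupp f k, Finset.mul_sum]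
      rw [integral_finsetSum]
      · refine Finset.sum_congr rfl fun n _ => ?_
        rw [← integral_const_mul]
        congr 1; funext x; ring
      · intro n _
        apply gint
        exact continuous_const.mul (continuous_char n)
    have := main_pair hsupp hf hN (fun n => ∫ x, g x * char n x) (B := C1 + C2 + 1)
      (by positivity)
      (fun y => (conv _ z1 y).trans (by linarith [(H1 N hN).2]))
      (fun y => (conv _ z2 y).trans (by linarith [(H2 N hN).2]))
    rw [← hval, Complex.norm_real] at this
    exact (le_abs_self _).trans this

lemma eLpNorm_interp {u : T2 → ℂ} (hu : Continuous u) {p A B : ℝ} (hp : 1 ≤ p) (hA : 0 ≤ A)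
    (h1 : ∀ x, ‖u x‖ ≤ A) (h2 : ∫ x, ‖u x‖ ≤ B) :
    eLpNorm u (ENNReal.ofReal p) volume ≤ ENNReal.ofReal ((A ^ (p - 1) * B) ^ (1 / p)) := by
  have hp0 : 0 < p := by linarith
  have hui : Integrable (fun x => ‖u x‖) (volume : Measure T2) :=
    hu.norm.integrable_of_hasCompactSupport (HasCompactSupport.of_compactSpace _)
  have hB : 0 ≤ B := (integral_nonneg fun x => norm_nonneg _).trans h2
  rw [eLpNorm_eq_lintegral_rpow_enorm_toReal (by simpa using hp0) (by simp),
    ENNReal.toReal_ofReal hp0.le, ← ENNReal.ofReal_rpow_of_nonneg (by positivity) (by positivity)]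
  gcongr
  calc ∫⁻ x, ‖u x‖ₑ ^ p ≤ ∫⁻ x, ENNReal.ofReal (A ^ (p - 1) * ‖u x‖) := by
        refine lintegral_mono fun x => ?_
        rw [← ofReal_norm, ENNReal.ofReal_rpow_of_nonneg (norm_nonneg _) hp0.le]
        apply ENNReal.ofReal_le_ofReal
        by_cases h : ‖u x‖ = 0
        · rw [h, Real.zero_rpow hp0.ne', mul_zero]
        · have e : ‖u x‖ ^ p = ‖u x‖ ^ (p - 1) * ‖u x‖ := by
            rw [← Real.rpow_add_one h]; simp
          rw [e]
          exact mul_le_mul_of_nonneg_right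
            (Real.rpow_le_rpow (norm_nonneg _) (h1 x) (by linarith)) (norm_nonneg _)
    _ = ENNReal.ofReal (∫ x, A ^ (p - 1) * ‖u x‖) := by
        rw [ofReal_integral_eq_lintegral_ofReal (hui.const_mul _)]
        exact Filter.Eventually.of_forall fun x => by positivity
    _ ≤ _ := by
        apply ENNReal.ofReal_le_ofReal
        rw [integral_const_mul]
        gcongr

/-- For `s ∈ [0,1)` and `1 ≤ p < 2/(s+1)` there is `C(s,p) > 0` such that for all
mean-zero `f ∈ BV(𝕋²)`, the Littlewood–Paley Besov norm satisfies
`‖f‖_{B^{s,p}_1} = Σ_{k≥0} 2^{sk} ‖Δ_k f‖_{L^p} ≤ C ‖f‖_{BV(𝕋²)}`. -/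
theorem besov_BV_embedding (ρ : ℝ × ℝ → ℝ) (hρ : ContDiff ℝ (⊤ : ℕ∞) ρ)
    (hsupp : ∀ ξ : ℝ × ℝ, ρ ξ ≠ 0 → 1/2 < ‖ξ‖ ∧ ‖ξ‖ < 2)
    (s : ℝ) (hs : s ∈ Set.Ico (0:ℝ) 1) (p : ℝ) (hp1 : 1 ≤ p) (hp2 : p < 2 / (s + 1)) :
    ∃ C : ℝ, 0 < C ∧ ∀ f : T2 → ℝ, IsBV f → (∫ x, f x) = 0 →
      (∑' k : ℕ, ENNReal.ofReal ((2:ℝ) ^ (s * k)) *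
          eLpNorm (LP ρ k f) (ENNReal.ofReal p) volume) ≤
        ENNReal.ofReal (C * bvNorm f) := by
  have hs0 : 0 ≤ s := hs.1
  have hp0 : 0 < p := by linarith
  obtain ⟨C, hC, H⟩ := LP_bounds hρ hsupp
  set e : ℝ := s + 1 - 2 / p with he
  have he0 : e < 0 := by
    have h1 : p * (s + 1) < 2 := by rwa [lt_div_iff₀ (by linarith)] at hp2
    have h2 : s + 1 < 2 / p := by rw [lt_div_iff₀ hp0]; linarith
    linarith
  set r : ℝ := (2:ℝ) ^ e with hr
  have hr0 : 0 < r := by positivity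
  have hr1 : r < 1 := Real.rpow_lt_one_of_one_lt_of_neg (by norm_num) he0
  refine ⟨(1 - r)⁻¹ * C, mul_pos (inv_pos.2 (by linarith)) hC, fun f hf _ => ?_⟩
  have hbv := bvNorm_nonneg hf
  set D := C * bvNorm f with hD
  have hD0 : 0 ≤ D := by positivity
  have term : ∀ k : ℕ, ENNReal.ofReal ((2:ℝ) ^ (s * k)) *
      eLpNorm (LP ρ k f) (ENNReal.ofReal p) volume ≤ ENNReal.ofReal (r ^ k * D) := by
    intro k
    obtain ⟨a1, a2⟩ := H f hf k
    have h := eLpNorm_interp (LP_continuous hsupp f k) hp1 (by positivity) a1 a2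
    rw [← hD] at h
    calc _ ≤ ENNReal.ofReal ((2:ℝ) ^ (s * k)) * ENNReal.ofReal
          ((((2:ℝ) ^ k * D) ^ (p - 1) * (((2:ℝ) ^ k)⁻¹ * D)) ^ (1 / p)) := by gcongr
      _ = ENNReal.ofReal (r ^ k * D) := by
        rw [← ENNReal.ofReal_mul (by positivity)]
        congr 1
        have e1 : (((2:ℝ) ^ k * D) ^ (p - 1) * (((2:ℝ) ^ k)⁻¹ * D)) =
            (2:ℝ) ^ ((k : ℝ) * (p - 2)) * D ^ p := by
          rw [Real.mul_rpow (by positivity) hD0, ← Real.rpow_natCast, ← Real.rpow_neg (by norm_num),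
            ← Real.rpow_mul (by norm_num)]
          have e2 : D ^ (p - 1) * D = D ^ p := by
            have := Real.rpow_add_of_nonneg hD0 (show 0 ≤ p - 1 by linarith) zero_le_one
            rw [Real.rpow_one] at this
            rw [← this]; congr 1; ring
          have e3 : (2:ℝ) ^ ((k : ℝ) * (p - 1)) * (2:ℝ) ^ (-(k : ℝ)) =
              (2:ℝ) ^ ((k : ℝ) * (p - 2)) := by
            rw [← Real.rpow_add (by norm_num)]; congr 1; ring
          rw [← e2, ← e3]; ring
        rw [e1, Real.mul_rpow (by positivity) (by positivity), ← Real.rpow_mul (by norm_num),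
          ← Real.rpow_mul hD0, mul_one_div_cancel hp0.ne', Real.rpow_one, ← mul_assoc,
          ← Real.rpow_add (by norm_num), hr, ← Real.rpow_natCast, ← Real.rpow_mul (by norm_num)]
        congr 2
        rw [he]; field_simp; ring
  refine (ENNReal.tsum_le_tsum term).trans (le_of_eq ?_)
  have hsum : Summable fun k : ℕ => r ^ k * D :=
    (summable_geometric_of_lt_one hr0.le hr1).mul_right D
  rw [← ENNReal.ofReal_tsum_of_nonneg (fun k => by positivity) hsum, tsum_mul_right,
    tsum_geometric_of_lt_one hr0.le hr1, hD]
  congr 1; ring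

end
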